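/- arXiv:2502.13709 — 2 statements merged into one kernel-verified Lean document; each statement's English description precedes it below -/
import Mathlib

section
/- Let e_1, …, e_n be pairwise orthogonal idempotents of A with e_1 + … + e_n = 1, and let M and N be finite-dimensional A-modules. For 1 ≤ i ≤ n set r_i := max{ dim_K(e_i · Im(f)) : f ∈ Hom_A(M,N) }. Then r(M,N) = r_1 + r_2 + … + r_n. -/
/-- The rank of an `A`-linear map between modules over a `K`-algebra `A`:
the `K`-dimension of its image. -/
noncomputable def rk (K : Type*) [Field K] {A : Type*} [Ring A] [Algebra K A]
    {M N : Type*} [AddCommGroup M] [Module A M]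
    [AddCommGroup N] [Module A N] [Module K N] [IsScalarTower K A N]
    (f : M →ₗ[A] N) : ℕ :=
  Module.finrank K ((LinearMap.range f).restrictScalars K)

/-- `rmax K A M N` is `r(M,N)`, the maximal rank of an `A`-linear map `M → N`. -/
noncomputable def rmax (K : Type*) [Field K] (A : Type*) [Ring A] [Algebra K A]
    (M N : Type*) [AddCommGroup M] [Module A M]
    [AddCommGroup N] [Module A N] [Module K N] [IsScalarTower K A N] : ℕ :=
  sSup {n : ℕ | ∃ f : M →ₗ[A] N, rk K f = n}

/-- For an element `a : A` and an `A`-submodule `U` of `N`, the `K`-subspace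
`a • U = {a • u : u ∈ U}` of `N`. -/
noncomputable def esub (K : Type*) [Field K] {A N : Type*} [Ring A] [Algebra K A]
    [AddCommGroup N] [Module A N] [Module K N] [IsScalarTower K A N]
    (a : A) (U : Submodule A N) : Submodule K N :=
  Submodule.span K {x : N | ∃ u ∈ U, a • u = x}

namespace LinearMap

section Perturbation

variable {K V W : Type*} [Field K] [AddCommGroup V] [Module K V] [AddCommGroup W] [Module K W]
  [FiniteDimensional K W]

/-- Lower semicontinuity of the rank along a line. -/
theorem finite_setOf_finrank_range_add_smul_lt (f g : V →ₗ[K] W) :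
    {t : K | Module.finrank K (range (f + t • g)) < Module.finrank K (range f)}.Finite := by
  obtain ⟨s, hs⟩ := f.rangeRestrict.exists_rightInverse_of_surjective f.range_rangeRestrict
  obtain ⟨q, hq⟩ := (range f).subtype.exists_leftInverse_of_injective (range f).ker_subtype
  have hfs (x : range f) : f (s x) = x := congrArg Subtype.val (LinearMap.congr_fun hs x)
  have hq' (x : range f) : q x = x := LinearMap.congr_fun hq x
  let B : Module.End K (range f) := q ∘ₗ g ∘ₗ s
  refine ((Module.End.finite_hasEigenvalue B).image fun μ => -μ⁻¹).subset fun t ht => ?_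
  have hnot : ¬ Function.Injective (q ∘ₗ (f + t • g) ∘ₗ s) := by
    intro hinj
    refine not_le.mpr (Set.mem_ofPred.mp ht) ?_
    have hmem (x : range f) : ((f + t • g) ∘ₗ s) x ∈ range (f + t • g) := ⟨s x, rfl⟩
    refine finrank_le_finrank_of_injective (f := ((f + t • g) ∘ₗ s).codRestrict _ hmem) ?_
    intro x y hxy
    exact hinj (congrArg q (congrArg Subtype.val hxy))
  rw [← ker_eq_bot, Submodule.eq_bot_iff] at hnot
  push Not at hnot
  obtain ⟨x, hx, hx0⟩ := hnot
  have hx' : x + t • B x = 0 := by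
    simpa [B, hfs, hq'] using hx
  have ht0 : t ≠ 0 := by
    rintro rfl
    simp at hx'
    exact hx0 hx'
  refine ⟨-t⁻¹, Module.End.hasEigenvalue_of_hasEigenvector (x := x)
    ⟨Module.End.mem_eigenspace_iff.mpr ?_, hx0⟩, by simp⟩
  have h : t • B x = -x := (neg_eq_of_add_eq_zero_right hx').symm
  rw [neg_smul, ← smul_neg, ← h, inv_smul_smul₀ ht0]

theorem finite_setOf_finrank_range_add_smul_lt_right (f g : V →ₗ[K] W) :
    {t : K | Module.finrank K (range (f + t • g)) < Module.finrank K (range g)}.Finite := by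
  refine (((finite_setOf_finrank_range_add_smul_lt g f).image fun t => t⁻¹).insert 0).subset
    fun t ht => ?_
  by_cases ht0 : t = 0
  · exact Or.inl ht0
  · refine Or.inr ⟨t⁻¹, ?_, inv_inv t⟩
    have h : f + t • g = t • (g + t⁻¹ • f) := by
      rw [smul_add, smul_inv_smul₀ ht0, add_comm]
    rwa [Set.mem_ofPred_eq, h, range_smul _ _ ht0] at ht

/-- Finitely many linear families of maps attain any individually attained ranks
simultaneously. -/
theorem exists_forall_finrank_range_le [Infinite K] {H ι : Type*} [AddCommGroup H] [Module K H]
    (Φ : ι → H →ₗ[K] V →ₗ[K] W) (g : ι → H) (s : Finset ι) :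
    ∃ h : H, ∀ i ∈ s, Module.finrank K (range (Φ i (g i))) ≤ Module.finrank K (range (Φ i h)) := by
  classical
  induction s using Finset.induction_on with
  | empty => exact ⟨0, by simp⟩
  | insert a s _ ih =>
    obtain ⟨h, hh⟩ := ih
    have hfin := (s.finite_toSet.biUnion fun i _ =>
      finite_setOf_finrank_range_add_smul_lt (Φ i h) (Φ i (g a))).union
      (finite_setOf_finrank_range_add_smul_lt_right (Φ a h) (Φ a (g a)))
    obtain ⟨t, ht⟩ := hfin.exists_notMem
    simp only [Set.mem_union, Set.mem_iUnion, Set.mem_ofPred_eq, not_or, not_exists, not_lt] at ht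
    refine ⟨h + t • g a, fun i hi => ?_⟩
    rw [map_add, map_smul]
    rcases Finset.mem_insert.mp hi with rfl | hi
    · exact ht.2
    · exact (hh i hi).trans (ht.1 i hi)

end Perturbation

end LinearMap

section Peirce

variable {K A M N : Type*} [Field K] [Ring A] [Algebra K A]
  [AddCommGroup M] [Module A M] [Module K M] [IsScalarTower K A M]
  [AddCommGroup N] [Module A N] [Module K N] [IsScalarTower K A N]

theorem mem_esub {a : A} {U : Submodule A N} {x : N} : x ∈ esub K a U ↔ ∃ u ∈ U, a • u = x := by
  have h : {x : N | ∃ u ∈ U, a • u = x} =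
      ((U.restrictScalars K).map (Algebra.lsmul K K N a) : Set N) := by
    ext x
    simp
  rw [esub, h, Submodule.span_eq]
  simp

theorem esub_range (a : A) (f : M →ₗ[A] N) :
    esub K a (LinearMap.range f) =
      LinearMap.range (Algebra.lsmul K K N a ∘ₗ f.restrictScalars K) := by
  ext x
  simp [mem_esub]

theorem finrank_eq_sum_finrank_esub [FiniteDimensional K N] {ι : Type*} [Fintype ι] {e : ι → A}
    (he : CompleteOrthogonalIdempotents e) (U : Submodule A N) :
    Module.finrank K (U.restrictScalars K) = ∑ i, Module.finrank K (esub K (e i) U) := by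
  classical
  rw [← Module.finrank_pi_fintype K]
  refine LinearEquiv.finrank_eq (LinearEquiv.ofBijective (LinearMap.pi fun i =>
    (Algebra.lsmul K K N (e i) ∘ₗ (U.restrictScalars K).subtype).codRestrict (esub K (e i) U)
      fun u => mem_esub.mpr ⟨u, u.2, rfl⟩) ⟨fun x y hxy => ?_, fun y => ?_⟩)
  · have h (i : ι) : e i • (x : N) = e i • (y : N) := congrArg Subtype.val (congrFun hxy i)
    ext
    rw [← one_smul A (x : N), ← one_smul A (y : N), ← he.complete, Finset.sum_smul,
      Finset.sum_smul]
    exact Finset.sum_congr rfl fun i _ => h i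
  · choose u hu huy using fun i => mem_esub.mp (y i).2
    refine ⟨⟨∑ i, e i • u i, U.sum_mem fun i _ => U.smul_mem _ (hu i)⟩, ?_⟩
    ext i
    change e i • ∑ j, e j • u j = y i
    rw [← huy, Finset.smul_sum, Finset.sum_eq_single i]
    · rw [smul_smul, (he.idem i).eq]
    · intro j _ hj
      rw [smul_smul, he.ortho hj.symm, zero_smul]
    · simp

end Peirce

theorem stmt1 {K A : Type*} [Field K] [IsAlgClosed K] [Ring A] [Algebra K A]
    [FiniteDimensional K A]
    {n : ℕ} (e : Fin n → A)
    (hidem : ∀ i, IsIdempotentElem (e i))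
    (horth : ∀ i j, i ≠ j → e i * e j = 0)
    (hsum : ∑ i, e i = 1)
    {M N : Type*}
    [AddCommGroup M] [Module A M] [Module K M] [IsScalarTower K A M] [FiniteDimensional K M]
    [AddCommGroup N] [Module A N] [Module K N] [IsScalarTower K A N] [FiniteDimensional K N] :
    rmax K A M N =
      ∑ i : Fin n, sSup {m : ℕ | ∃ f : M →ₗ[A] N,
        Module.finrank K (esub K (e i) (LinearMap.range f)) = m} := by
  have he : CompleteOrthogonalIdempotents e := ⟨⟨hidem, fun i j hij => horth i j hij⟩, hsum⟩
  have hrk (f : M →ₗ[A] N) :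
      rk K f = ∑ i, Module.finrank K (esub K (e i) (LinearMap.range f)) :=
    finrank_eq_sum_finrank_esub he _
  have hbdd (i : Fin n) : BddAbove {m : ℕ | ∃ f : M →ₗ[A] N,
      Module.finrank K (esub K (e i) (LinearMap.range f)) = m} :=
    ⟨Module.finrank K N, by rintro _ ⟨f, rfl⟩; exact Submodule.finrank_le _⟩
  have hbdd' : BddAbove {m : ℕ | ∃ f : M →ₗ[A] N, rk K f = m} :=
    ⟨Module.finrank K N, by rintro _ ⟨f, rfl⟩; exact Submodule.finrank_le _⟩
  apply le_antisymm
  · refine csSup_le ⟨_, 0, rfl⟩ ?_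
    rintro _ ⟨f, rfl⟩
    rw [hrk]
    exact Finset.sum_le_sum fun i _ => le_csSup (hbdd i) ⟨f, rfl⟩
  · choose g hg using fun i => Nat.sSup_mem (Set.range_nonempty _) (hbdd i)
    have : Infinite K := IsAlgClosed.instInfinite
    let Φ (i : Fin n) : (M →ₗ[A] N) →ₗ[K] M →ₗ[K] N :=
      { toFun := fun f => Algebra.lsmul K K N (e i) ∘ₗ f.restrictScalars K
        map_add' := fun f f' => by ext; simp
        map_smul' := fun c f => by ext x; exact smul_comm (e i) c (f x) }
    obtain ⟨h, hh⟩ := LinearMap.exists_forall_finrank_range_le Φ g Finset.univ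
    refine le_trans (Finset.sum_le_sum fun i hi => ?_)
      ((hrk h).symm.le.trans (le_csSup hbdd' ⟨h, rfl⟩))
    refine (hg i).symm.le.trans ?_
    beta_reduce
    rw [esub_range, esub_range]
    exact hh i hi
end

section
/- Let S be a simple projective A-module with dim_K(S) = 1, and let P_1 and P_0 be finite-dimensional projective A-modules. Assume that every homomorphism f : P_1 → P_0 with rank(f) = r(P_1,P_0) has the property that no nonzero direct summand of P_1 is contained in Ker(f). Then r(P_1, P_0 ⊕ S) = r(P_1, P_0). Moreover, for every homomorphism h = (f,g) : P_1 → P_0 ⊕ S whose component f : P_1 → P_0 satisfies rank(f) = r(P_1,P_0), one has Ker(h) = Ker(f) and rank(h) = r(P_1, P_0 ⊕ S). -/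
/-- `U` is a direct summand of `P`: it has a complementary submodule. -/
def IsDirectSummand {A P : Type*} [Ring A] [AddCommGroup P] [Module A P]
    (U : Submodule A P) : Prop :=
  ∃ V : Submodule A P, IsCompl U V

section

variable {K A M N S : Type*} [Field K] [Ring A] [Algebra K A]
  [AddCommGroup M] [Module A M] [AddCommGroup N] [Module A N] [AddCommGroup S] [Module A S]

theorem ker_le_ker_of_forall_isDirectSummand_eq_bot [IsSimpleModule A S] [Module.Projective A S]
    (f : M →ₗ[A] N) (g : M →ₗ[A] S)
    (h : ∀ U : Submodule A M, IsDirectSummand U → U ≤ LinearMap.ker f → U = ⊥) :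
    LinearMap.ker f ≤ LinearMap.ker g := by
  rcases (g.domRestrict (LinearMap.ker f)).surjective_or_eq_zero with hsurj | hzero
  · obtain ⟨s, hs⟩ := Module.projective_lifting_property _ LinearMap.id hsurj
    have hgs : ∀ y, g (s y) = y := fun y => LinearMap.congr_fun hs y
    have hcompl : IsCompl (LinearMap.range ((LinearMap.ker f).subtype ∘ₗ s)) (LinearMap.ker g) := by
      refine IsCompl.of_eq ?_ ?_
      · rw [eq_bot_iff]
        rintro _ ⟨⟨y, rfl⟩, hy⟩
        have hy0 : y = 0 := (hgs y).symm.trans hy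
        simp [hy0]
      · rw [eq_top_iff]
        intro x _
        refine Submodule.mem_sup.2 ⟨s (g x), ⟨g x, rfl⟩, x - s (g x), ?_, by abel⟩
        simp [hgs]
    have hbot := h _ ⟨_, hcompl⟩ (by rintro _ ⟨y, rfl⟩; exact (s y).2)
    have := IsSimpleModule.nontrivial A S
    obtain ⟨y, hy⟩ := exists_ne (0 : S)
    have hmem : (s y : M) ∈ LinearMap.range ((LinearMap.ker f).subtype ∘ₗ s) := ⟨y, rfl⟩
    rw [hbot, Submodule.mem_bot] at hmem
    exact absurd (by rw [← hgs y, hmem, map_zero]) hy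
  · exact fun x hx => LinearMap.congr_fun hzero ⟨x, hx⟩

variable [Module K N] [IsScalarTower K A N] [Module K S] [IsScalarTower K A S]

theorem rk_le_rmax [FiniteDimensional K N] (f : M →ₗ[A] N) : rk K f ≤ rmax K A M N := by
  refine le_csSup ⟨Module.finrank K N, ?_⟩ ⟨f, rfl⟩
  rintro _ ⟨f', rfl⟩
  exact Submodule.finrank_le _

theorem exists_rk_eq_rmax (K A M N : Type*) [Field K] [Ring A] [Algebra K A]
    [AddCommGroup M] [Module A M] [AddCommGroup N] [Module A N] [Module K N]
    [IsScalarTower K A N] [FiniteDimensional K N] :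
    ∃ f : M →ₗ[A] N, rk K f = rmax K A M N := by
  refine Nat.sSup_mem (s := {n : ℕ | ∃ f : M →ₗ[A] N, rk K f = n}) ⟨_, 0, rfl⟩
    ⟨Module.finrank K N, ?_⟩
  rintro _ ⟨f', rfl⟩
  exact Submodule.finrank_le _

theorem rk_prod_le [FiniteDimensional K N] [FiniteDimensional K S]
    (f : M →ₗ[A] N) (g : M →ₗ[A] S) :
    rk K (f.prod g) ≤ rk K f + Module.finrank K S := by
  have hle : (LinearMap.range (f.prod g)).restrictScalars K ≤
      LinearMap.range (((LinearMap.range f).restrictScalars K).subtype.prodMap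
        (LinearMap.id : S →ₗ[K] S)) := by
    rintro _ ⟨x, rfl⟩
    exact ⟨(⟨f x, x, rfl⟩, g x), rfl⟩
  calc rk K (f.prod g) ≤ _ := Submodule.finrank_mono hle
    _ ≤ _ := LinearMap.finrank_range_le _
    _ = _ := Module.finrank_prod

theorem rk_eq_of_ker_eq [Module K M] [IsScalarTower K A M] [FiniteDimensional K M]
    {f : M →ₗ[A] N} {g : M →ₗ[A] S} (h : LinearMap.ker f = LinearMap.ker g) :
    rk K f = rk K g := by
  have hf := (f.restrictScalars K).finrank_range_add_finrank_ker
  have hg := (g.restrictScalars K).finrank_range_add_finrank_ker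
  rw [LinearMap.ker_restrictScalars] at hf hg
  rw [h, ← hg] at hf
  exact Nat.add_right_cancel hf

end

theorem stmt3 {K A : Type*} [Field K] [IsAlgClosed K] [Ring A] [Algebra K A]
    [FiniteDimensional K A]
    {S : Type*} [AddCommGroup S] [Module A S] [Module K S] [IsScalarTower K A S]
    [FiniteDimensional K S]
    (hSsimple : IsSimpleModule A S) (hSproj : Module.Projective A S)
    (hSdim : Module.finrank K S = 1)
    {P₁ P₀ : Type*}
    [AddCommGroup P₁] [Module A P₁] [Module K P₁] [IsScalarTower K A P₁] [FiniteDimensional K P₁]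
    [AddCommGroup P₀] [Module A P₀] [Module K P₀] [IsScalarTower K A P₀] [FiniteDimensional K P₀]
    (hP₁proj : Module.Projective A P₁) (hP₀proj : Module.Projective A P₀)
    (hyp : ∀ f : P₁ →ₗ[A] P₀, rk K f = rmax K A P₁ P₀ →
      ∀ U : Submodule A P₁, IsDirectSummand U → U ≤ LinearMap.ker f → U = ⊥) :
    rmax K A P₁ (P₀ × S) = rmax K A P₁ P₀ ∧
      ∀ (f : P₁ →ₗ[A] P₀) (g : P₁ →ₗ[A] S), rk K f = rmax K A P₁ P₀ →
        LinearMap.ker (LinearMap.prod f g) = LinearMap.ker f ∧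
        rk K (LinearMap.prod f g) = rmax K A P₁ (P₀ × S) := by
  have hker (f : P₁ →ₗ[A] P₀) (g : P₁ →ₗ[A] S) (hf : rk K f = rmax K A P₁ P₀) :
      LinearMap.ker (LinearMap.prod f g) = LinearMap.ker f := by
    rw [LinearMap.ker_prod, inf_eq_left]
    exact ker_le_ker_of_forall_isDirectSummand_eq_bot f g (hyp f hf)
  have hrmax : rmax K A P₁ (P₀ × S) = rmax K A P₁ P₀ := by
    apply le_antisymm
    · obtain ⟨h, hh⟩ := exists_rk_eq_rmax K A P₁ (P₀ × S)
      obtain ⟨f, g, rfl⟩ : ∃ f g, h = LinearMap.prod f g :=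
        ⟨LinearMap.fst A P₀ S ∘ₗ h, LinearMap.snd A P₀ S ∘ₗ h, rfl⟩
      rw [← hh]
      rcases (rk_le_rmax (K := K) f).eq_or_lt with hf | hf
      · rw [rk_eq_of_ker_eq (hker f g hf), hf]
      · have := rk_prod_le (K := K) f g
        omega
    · obtain ⟨f, hf⟩ := exists_rk_eq_rmax K A P₁ P₀
      rw [← hf, ← rk_eq_of_ker_eq (K := K) (hker f 0 hf)]
      exact rk_le_rmax _
  exact ⟨hrmax, fun f g hf =>
    ⟨hker f g hf, by rw [rk_eq_of_ker_eq (hker f g hf), hf, hrmax]⟩⟩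
end
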